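/- Assume δ ≠ 0. Let O ⊆ {1,…,c} be a set of labels, let p_O = ∑_{i∈O} Pr(i ∈ f_{k'}(X)), and let p̄_O be a real number with p_O ≤ p̄_O and 0 < p̄_O/k' < 1. Define B_O = {w ∈ ℝ^d : δᵀ(w − x) ≥ σ‖δ‖₂ Φ⁻¹(1 − p̄_O/k')}. Then (1/k') ∑_{i∈O} Pr(i ∈ f_{k'}(X)) ≤ Pr(X ∈ B_O) and (1/k') ∑_{i∈O} Pr(i ∈ f_{k'}(Y)) ≤ Pr(Y ∈ B_O). -/

import Mathlib

open MeasureTheory ProbabilityTheory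

/-- Isotropic Gaussian measure `N(m, σ²I)` on `ℝ^d`, as a product of 1-D Gaussians. -/
noncomputable def gaussPi (d : ℕ) (m : Fin d → ℝ) (σ : ℝ) : Measure (Fin d → ℝ) :=
  Measure.pi fun i => gaussianReal (m i) ⟨σ ^ 2, sq_nonneg σ⟩

/-- Standard Gaussian CDF `Φ`. -/
noncomputable def Phi (x : ℝ) : ℝ := (gaussianReal 0 1 (Set.Iic x)).toReal

/-- Inverse of the standard Gaussian CDF, `Φ⁻¹` (genuine inverse on `(0,1)` since `Φ` is a
strictly increasing continuous bijection from `ℝ` onto `(0,1)`). -/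
noncomputable def PhiInv : ℝ → ℝ := Function.invFun Phi

/-- Euclidean dot product `aᵀb` on `ℝ^d`. -/
noncomputable def dotp (d : ℕ) (a b : Fin d → ℝ) : ℝ := ∑ i, a i * b i

/-- Euclidean norm `‖a‖₂` on `ℝ^d`. -/
noncomputable def enorm2 (d : ℕ) (a : Fin d → ℝ) : ℝ := Real.sqrt (∑ i, a i ^ 2)

/-- A product of densities is a density of the product measure. -/
theorem pi_withDensity_eq {ι : Type*} [Fintype ι] {α : ι → Type*} [∀ i, MeasurableSpace (α i)]
    (μ : ∀ i, Measure (α i)) [∀ i, IsProbabilityMeasure (μ i)] (g : ∀ i, α i → ENNReal)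
    (hg : ∀ i, Measurable (g i)) [∀ i, SigmaFinite ((μ i).withDensity (g i))] :
    Measure.pi (fun i => (μ i).withDensity (g i)) =
      (Measure.pi μ).withDensity (fun w => ∏ i, g i (w i)) := by
  refine Measure.pi_eq fun s hs => ?_
  have hind : iIndepFun (fun i (w : ∀ i, α i) => (s i).indicator (g i) (w i)) (Measure.pi μ) :=
    iIndepFun_pi fun i => ((hg i).indicator (hs i)).aemeasurable
  have hmul := lintegral_prod_eq_prod_lintegral_of_indepFun Finset.univ _ hind
    fun i => ((hg i).indicator (hs i)).comp (measurable_pi_apply i)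
  rw [withDensity_apply _ (MeasurableSet.univ_pi hs),
    ← lintegral_indicator (MeasurableSet.univ_pi hs)]
  convert hmul using 2 with i
  · funext w
    by_cases hw : w ∈ Set.univ.pi s
    · rw [Set.indicator_of_mem hw]
      exact Finset.prod_congr rfl fun i _ =>
        (Set.indicator_of_mem (hw i trivial) _).symm
    · rw [Set.indicator_of_notMem hw]
      obtain ⟨i, hi⟩ : ∃ i, w i ∉ s i := by simpa [Set.mem_univ_pi] using hw
      exact (Finset.prod_eq_zero (Finset.mem_univ i) (Set.indicator_of_notMem hi _)).symm
  · rw [withDensity_apply _ (hs i), ← lintegral_indicator (hs i)]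
    exact ((measurePreserving_eval μ i).lintegral_comp ((hg i).indicator (hs i))).symm

/-- The likelihood ratio between two real Gaussians of the same variance. -/
theorem gaussianReal_add_mean_eq_withDensity (m a : ℝ) {v : NNReal} (hv : v ≠ 0) :
    gaussianReal (m + a) v = (gaussianReal m v).withDensity
      (fun w => ENNReal.ofReal (Real.exp ((a * (w - m) - a ^ 2 / 2) / v))) := by
  have hv' : (v : ℝ) ≠ 0 := by exact_mod_cast hv
  rw [gaussianReal_of_var_ne_zero _ hv, gaussianReal_of_var_ne_zero _ hv,
    ← withDensity_mul _ (measurable_gaussianPDF _ _) (by fun_prop)]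
  congr 1
  funext w
  simp only [gaussianPDF, Pi.mul_apply]
  rw [← ENNReal.ofReal_mul (gaussianPDFReal_nonneg _ _ _)]
  simp only [gaussianPDFReal]
  rw [mul_assoc (√_)⁻¹, ← Real.exp_add]
  congr 3
  field_simp
  ring

/-- A linear functional of independent real Gaussians is Gaussian. -/
theorem map_sum_mul_pi_gaussianReal {ι : Type*} [Fintype ι] (a m : ι → ℝ) (v : NNReal) :
    (Measure.pi fun i => gaussianReal (m i) v).map (fun w => ∑ i, a i * w i) =
      gaussianReal (∑ i, a i * m i) (∑ i, (NNReal.mk (a i ^ 2) (sq_nonneg _) * v)) := by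
  have hmeas : Measurable fun w : ι → ℝ => ∑ i, a i * w i := by fun_prop
  have : IsProbabilityMeasure
      ((Measure.pi fun i => gaussianReal (m i) v).map (fun w => ∑ i, a i * w i)) :=
    Measure.isProbabilityMeasure_map hmeas.aemeasurable
  refine Measure.ext_of_charFun (funext fun t => ?_)
  rw [charFun_gaussianReal, charFun_apply_real, integral_map hmeas.aemeasurable (by fun_prop)]
  have hprod : ∀ w : ι → ℝ, Complex.exp (t * (∑ i, a i * w i : ℝ) * Complex.I) =
      ∏ i, Complex.exp ((t * a i : ℝ) * (w i) * Complex.I) := fun w => by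
    rw [← Complex.exp_sum]
    push_cast
    rw [Finset.mul_sum, Finset.sum_mul]
    exact congrArg _ (Finset.sum_congr rfl fun i _ => by ring)
  simp_rw [hprod]
  rw [integral_fintype_prod_eq_prod
    (f := fun i (z : ℝ) => Complex.exp ((t * a i : ℝ) * z * Complex.I))]
  simp_rw [← charFun_apply_real, charFun_gaussianReal]
  rw [← Complex.exp_sum]
  push_cast
  rw [Finset.sum_sub_distrib, Finset.mul_sum, Finset.sum_mul, Finset.sum_mul, Finset.sum_div]
  refine congrArg _ (congrArg₂ _ (Finset.sum_congr rfl fun i _ => by ring)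
    (Finset.sum_congr rfl fun i _ => by ring))

/-- The Neyman–Pearson lemma for a randomised test `φ`. -/
theorem neyman_pearson {α : Type*} [MeasurableSpace α] {μ ν : Measure α} [IsFiniteMeasure μ]
    [IsFiniteMeasure ν] {L : α → ℝ} (hL : Measurable L) (hL0 : ∀ w, 0 ≤ L w)
    (hν : ν = μ.withDensity (fun w => ENNReal.ofReal (L w))) {φ : α → ℝ} (hφ : Measurable φ)
    (hφ0 : ∀ w, 0 ≤ φ w) (hφ1 : ∀ w, φ w ≤ 1) {t : ℝ} (ht : 0 ≤ t)
    (h : ∫ w, φ w ∂μ ≤ μ.real {w | t ≤ L w}) :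
    ∫ w, φ w ∂ν ≤ ν.real {w | t ≤ L w} := by
  have hB : MeasurableSet {w | t ≤ L w} := measurableSet_le measurable_const hL
  set ψ : α → ℝ := {w | t ≤ L w}.indicator 1 with hψ
  have hψm : Measurable ψ := measurable_one.indicator hB
  have hψb : ∀ w, ‖ψ w‖ ≤ 1 := fun w => by
    by_cases hw : w ∈ {w | t ≤ L w} <;> simp [hψ, hw]
  have hφb : ∀ w, ‖φ w‖ ≤ 1 := fun w => by
    rw [Real.norm_of_nonneg (hφ0 w)]
    exact hφ1 w
  have hint : ∀ g : α → ℝ, ∫ w, g w ∂ν = ∫ w, L w * g w ∂μ := fun g => by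
    rw [hν, integral_withDensity_eq_integral_toReal_smul (by fun_prop) (by simp)]
    simp [ENNReal.toReal_ofReal, hL0]
  have hLi : Integrable L μ := by
    refine ⟨hL.aestronglyMeasurable, ?_⟩
    rw [hasFiniteIntegral_iff_ofReal (.of_forall hL0), ← setLIntegral_univ,
      ← withDensity_apply _ MeasurableSet.univ, ← hν]
    exact measure_lt_top _ _
  have hi : ∀ g : α → ℝ, Measurable g → (∀ w, ‖g w‖ ≤ 1) → Integrable g μ := fun g hg hb =>
    .of_bound hg.aestronglyMeasurable 1 (.of_forall hb)
  have hiL : ∀ g : α → ℝ, Measurable g → (∀ w, ‖g w‖ ≤ 1) →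
      Integrable (fun w => L w * g w) μ := fun g hg hb =>
    hLi.mul_bdd hg.aestronglyMeasurable (.of_forall hb)
  have hmain : ∫ w, t * (ψ w - φ w) ∂μ ≤ ∫ w, (L w * ψ w - L w * φ w) ∂μ := by
    refine integral_mono (((hi ψ hψm hψb).sub (hi φ hφ hφb)).const_mul t)
      ((hiL ψ hψm hψb).sub (hiL φ hφ hφb)) fun w => ?_
    by_cases hw : t ≤ L w
    · have : ψ w = 1 := by simp [hψ, hw]
      simp only [this]
      nlinarith [hφ1 w]
    · have : ψ w = 0 := by simp [hψ, hw]
      simp only [this]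
      nlinarith [hφ0 w]
  rw [integral_const_mul, integral_sub (hi ψ hψm hψb) (hi φ hφ hφb),
    integral_sub (hiL ψ hψm hψb) (hiL φ hφ hφb), ← hint, ← hint, hψ,
    integral_indicator_one hB, integral_indicator_one hB] at hmain
  nlinarith [mul_nonneg ht (sub_nonneg.2 h)]

theorem Phi_eq_cdf : Phi = cdf (gaussianReal 0 1) := by
  funext q
  rw [cdf_eq_real]
  rfl

theorem continuous_Phi : Continuous Phi := by
  have := nullSingletonClass_gaussianReal (μ := 0) (v := 1) one_ne_zero
  rw [Phi_eq_cdf, continuous_iff_continuousAt]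
  intro q
  rw [(monotone_cdf _).continuousAt_iff_leftLim_eq_rightLim, StieltjesFunction.rightLim_eq]
  have h := (cdf (gaussianReal 0 1)).measure_singleton q
  rw [measure_cdf, measure_singleton, eq_comm, ENNReal.ofReal_eq_zero, sub_nonpos] at h
  exact le_antisymm ((monotone_cdf _).leftLim_le le_rfl) h

theorem Phi_PhiInv {y : ℝ} (h0 : 0 < y) (h1 : y < 1) : Phi (PhiInv y) = y := by
  refine Function.invFun_eq ?_
  refine mem_range_of_exists_le_of_exists_ge continuous_Phi ?_ ?_
  · rw [Phi_eq_cdf]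
    exact ((tendsto_cdf_atBot _).eventually_le_const h0).exists
  · rw [Phi_eq_cdf]
    exact ((tendsto_cdf_atTop _).eventually_const_le h1).exists

theorem gaussianReal_real_Ici (q : ℝ) : (gaussianReal 0 1).real (Set.Ici q) = 1 - Phi q := by
  have := nullSingletonClass_gaussianReal (μ := 0) (v := 1) one_ne_zero
  rw [← Set.compl_Iio, probReal_compl_eq_one_sub measurableSet_Iio,
    measureReal_congr Iio_ae_eq_Iic]
  rfl

theorem gaussPi_eq_pi (d : ℕ) (m : Fin d → ℝ) (σ : ℝ) :
    gaussPi d m σ = Measure.pi fun i => gaussianReal (m i) (NNReal.mk (σ ^ 2) (sq_nonneg σ)) :=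
  rfl

instance (d : ℕ) (m : Fin d → ℝ) (σ : ℝ) : IsProbabilityMeasure (gaussPi d m σ) := by
  rw [gaussPi_eq_pi]
  infer_instance

theorem enorm2_sq (d : ℕ) (a : Fin d → ℝ) : enorm2 d a ^ 2 = ∑ i, a i ^ 2 :=
  Real.sq_sqrt (Finset.sum_nonneg fun _ _ => sq_nonneg _)

theorem enorm2_pos {d : ℕ} {a : Fin d → ℝ} (ha : a ≠ 0) : 0 < enorm2 d a := by
  obtain ⟨i, hi⟩ := Function.ne_iff.1 ha
  exact Real.sqrt_pos.2 (Finset.sum_pos' (fun _ _ => sq_nonneg _)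
    ⟨i, Finset.mem_univ i, sq_pos_of_ne_zero hi⟩)

theorem gaussPi_add_eq_withDensity {d : ℕ} (x δ : Fin d → ℝ) {σ : ℝ} (hσ : 0 < σ) :
    gaussPi d (x + δ) σ = (gaussPi d x σ).withDensity (fun w =>
      ENNReal.ofReal (Real.exp ((dotp d δ (w - x) - enorm2 d δ ^ 2 / 2) / σ ^ 2))) := by
  have hv : NNReal.mk (σ ^ 2) (sq_nonneg σ) ≠ 0 := fun h =>
    (pow_pos hσ 2).ne' (congrArg NNReal.toReal h)
  have hshift := fun i => gaussianReal_add_mean_eq_withDensity (x i) (δ i) hv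
  have : ∀ i, SigmaFinite ((gaussianReal (x i) (NNReal.mk (σ ^ 2) (sq_nonneg σ))).withDensity
      (fun w => ENNReal.ofReal (Real.exp ((δ i * (w - x i) - δ i ^ 2 / 2) /
        (NNReal.mk (σ ^ 2) (sq_nonneg σ) : ℝ))))) := fun i => by
    rw [← hshift i]
    infer_instance
  simp only [gaussPi_eq_pi, Pi.add_apply, hshift]
  rw [pi_withDensity_eq _ _ fun i => by fun_prop]
  congr 1
  funext w
  rw [← ENNReal.ofReal_prod_of_nonneg fun i _ => (Real.exp_pos _).le, ← Real.exp_sum,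
    ← Finset.sum_div, Finset.sum_sub_distrib, ← Finset.sum_div, enorm2_sq]
  rfl

theorem gaussPi_real_halfSpace {d : ℕ} (x : Fin d → ℝ) {δ : Fin d → ℝ} (hδ : δ ≠ 0) {σ : ℝ}
    (hσ : 0 < σ) (q : ℝ) :
    (gaussPi d x σ).real {w | σ * enorm2 d δ * q ≤ dotp d δ (w - x)} = 1 - Phi q := by
  have hn := enorm2_pos hδ
  have hpos : 0 < σ * enorm2 d δ := mul_pos hσ hn
  set a : Fin d → ℝ := fun i => δ i / (σ * enorm2 d δ) with ha
  have hmap : (gaussPi d x σ).map (fun w => ∑ i, a i * w i - ∑ i, a i * x i) =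
      gaussianReal 0 1 := by
    have hcomp := Measure.map_map (μ := gaussPi d x σ) (g := fun z : ℝ => z - ∑ i, a i * x i)
      (f := fun w : Fin d → ℝ => ∑ i, a i * w i) (by fun_prop) (by fun_prop)
    rw [gaussPi_eq_pi, map_sum_mul_pi_gaussianReal, gaussianReal_map_sub_const, sub_self] at hcomp
    refine hcomp.symm.trans (congrArg _ (NNReal.coe_injective ?_))
    push_cast
    change ∑ i, a i ^ 2 * σ ^ 2 = 1
    rw [← Finset.sum_mul]
    simp only [ha, div_pow]
    rw [← Finset.sum_div, ← enorm2_sq]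
    field_simp
  rw [← gaussianReal_real_Ici, ← hmap, map_measureReal_apply (by fun_prop) measurableSet_Ici]
  congr 1
  ext w
  have hsum : ∑ i, a i * w i - ∑ i, a i * x i = dotp d δ (w - x) / (σ * enorm2 d δ) := by
    rw [← Finset.sum_sub_distrib, dotp, Finset.sum_div]
    exact Finset.sum_congr rfl fun i _ => by simp only [ha, Pi.sub_apply]; ring
  simp only [Set.mem_ofPred_eq, Set.mem_preimage, Set.mem_Ici, hsum]
  rw [le_div_iff₀ hpos, mul_comm]

/-- Lemma 5 (second halves), for a set `O` of labels: with `p_O = ∑_{i∈O} Pr(i ∈ f_{k'}(X)) ≤ p̄_O`,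
`0 < p̄_O/k' < 1`, and `B_O = {w | δᵀ(w−x) ≥ σ‖δ‖₂ Φ⁻¹(1 − p̄_O/k')}`, we have
`(1/k') ∑_{i∈O} Pr(i ∈ f_{k'}(X)) ≤ Pr(X ∈ B_O)` and
`(1/k') ∑_{i∈O} Pr(i ∈ f_{k'}(Y)) ≤ Pr(Y ∈ B_O)`, where `X ~ N(x,σ²I)`, `Y ~ N(x+δ,σ²I)`
and the base classifier `f` outputs exactly `k'` labels from `{1,…,c}`. -/
theorem stmt9 {d : ℕ} (c k' : ℕ) (hk' : 1 ≤ k')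
    (x δ : Fin d → ℝ) (hδ : δ ≠ 0) (σ : ℝ) (hσ : 0 < σ)
    (f : (Fin d → ℝ) → Finset (Fin c)) (hfcard : ∀ w, (f w).card = k')
    (hfm : ∀ i : Fin c, MeasurableSet {w : Fin d → ℝ | i ∈ f w})
    (O : Finset (Fin c)) (pOupp : ℝ)
    (hupp : ∑ i ∈ O, ((gaussPi d x σ) {w | i ∈ f w}).toReal ≤ pOupp)
    (h0 : 0 < pOupp / (k' : ℝ)) (hlt : pOupp / (k' : ℝ) < 1)
    (B : Set (Fin d → ℝ))
    (hB : B = {w | σ * enorm2 d δ * PhiInv (1 - pOupp / (k' : ℝ)) ≤ dotp d δ (w - x)}) :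
    (1 / (k' : ℝ)) * ∑ i ∈ O, ((gaussPi d x σ) {w | i ∈ f w}).toReal ≤
        ((gaussPi d x σ) B).toReal ∧
    (1 / (k' : ℝ)) * ∑ i ∈ O, ((gaussPi d (x + δ) σ) {w | i ∈ f w}).toReal ≤
        ((gaussPi d (x + δ) σ) B).toReal := by
  have hk : (0 : ℝ) < k' := by exact_mod_cast hk'
  set φ : (Fin d → ℝ) → ℝ := fun w =>
    (1 / (k' : ℝ)) * ∑ i ∈ O, {w | i ∈ f w}.indicator (1 : (Fin d → ℝ) → ℝ) w with hφ
  have hφint : ∀ (ν : Measure (Fin d → ℝ)) [IsFiniteMeasure ν],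
      (1 / (k' : ℝ)) * ∑ i ∈ O, (ν {w | i ∈ f w}).toReal = ∫ w, φ w ∂ν := fun ν _ => by
    rw [integral_const_mul, integral_finsetSum _ fun i _ =>
      (show Integrable ({w | i ∈ f w}.indicator 1) ν from
        (integrable_const (1 : ℝ)).indicator (hfm i))]
    exact congrArg _ (Finset.sum_congr rfl fun i _ => (integral_indicator_one (hfm i)).symm)
  have hφ0 : ∀ w, 0 ≤ φ w := fun w => mul_nonneg (by positivity)
    (Finset.sum_nonneg fun i _ => Set.indicator_nonneg (fun _ _ => zero_le_one) _)
  have hφ1 : ∀ w, φ w ≤ 1 := fun w => by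
    have hcard : ∑ i ∈ O, {w | i ∈ f w}.indicator (1 : (Fin d → ℝ) → ℝ) w ≤ k' := by
      simp only [Set.indicator_apply, Set.mem_ofPred_eq, Pi.one_apply, Finset.sum_boole]
      rw [← hfcard w]
      exact_mod_cast Finset.card_le_card fun i hi => (Finset.mem_filter.1 hi).2
    rw [hφ]
    simp only
    rw [one_div, inv_mul_le_iff₀ hk, mul_one]
    exact hcard
  have hφm : Measurable φ := (Finset.measurable_sum _ fun i _ =>
    measurable_one.indicator (hfm i)).const_mul _
  set q := PhiInv (1 - pOupp / (k' : ℝ))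
  have hX : ∫ w, φ w ∂(gaussPi d x σ) ≤ (gaussPi d x σ).real B := by
    rw [hB, gaussPi_real_halfSpace x hδ hσ, Phi_PhiInv (by linarith) (by linarith), ← hφint,
      sub_sub_cancel, one_div, inv_mul_eq_div]
    gcongr
  rw [hφint, hφint]
  refine ⟨hX, ?_⟩
  have hBL : B = {w | Real.exp ((σ * enorm2 d δ * q - enorm2 d δ ^ 2 / 2) / σ ^ 2) ≤
      Real.exp ((dotp d δ (w - x) - enorm2 d δ ^ 2 / 2) / σ ^ 2)} := by
    rw [hB]
    ext w
    simp only [Set.mem_ofPred_eq]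
    rw [Real.exp_le_exp, div_le_div_iff_of_pos_right (pow_pos hσ 2), sub_le_sub_iff_right]
  rw [hBL] at hX ⊢
  exact neyman_pearson (by unfold dotp; fun_prop) (fun _ => (Real.exp_pos _).le)
    (gaussPi_add_eq_withDensity x δ hσ) hφm hφ0 hφ1 (Real.exp_pos _).le hX
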